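/- arXiv:2112.02371 — 2 statements merged into one kernel-verified Lean document; each statement's English description precedes it below -/
import Mathlib

section
/- Let (Σ_M, σ) be an irreducible topological Markov chain with ultrametric d_λ, λ > 1, Q a periodic orbit, and G^s(Q) the stable groupoid. If a ∈ G^s(Q) satisfies c_s(a) = N and n ≥ N is an integer, then V^s(a, λ^{−n−1}, n) ⊆ c_s^{−1}(N); that is, every b ∈ V^s(a, λ^{−n−1}, n) satisfies c_s(b) = N. -/
open scoped Classical

/-- A sequence `x : ℤ → Fin m` is allowable for the 0-1 matrix `M` if all its
transitions are allowed. -/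
def IsMarkov {m : ℕ} (M : Fin m → Fin m → Bool) (x : ℤ → Fin m) : Prop :=
  ∀ i : ℤ, M (x i) (x (i + 1)) = true

/-- The topological Markov chain `Σ_M` of allowable bi-infinite sequences. -/
def TMC {m : ℕ} (M : Fin m → Fin m → Bool) : Type := {x : ℤ → Fin m // IsMarkov M x}

namespace TMC

variable {m : ℕ} {M : Fin m → Fin m → Bool}

instance : TopologicalSpace (TMC M) :=
  inferInstanceAs (TopologicalSpace {x : ℤ → Fin m // IsMarkov M x})

/-- The shift homeomorphism `σ(x)_i = x_{i+1}`. -/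
def shift (M : Fin m → Fin m → Bool) (x : TMC M) : TMC M :=
  ⟨fun i => x.1 (i + 1), fun i => x.2 (i + 1)⟩

/-- The inverse shift `σ⁻¹(x)_i = x_{i-1}`. -/
def shiftInv (M : Fin m → Fin m → Bool) (x : TMC M) : TMC M :=
  ⟨fun i => x.1 (i - 1), fun i => by
    have h : i + 1 - 1 = i - 1 + 1 := by ring
    show M (x.1 (i - 1)) (x.1 (i + 1 - 1)) = true
    rw [h]
    exact x.2 (i - 1)⟩

/-- The ultrametric `d_λ(x,y) = inf{λ^{-n} : n ≥ 0, xᵢ = yᵢ for |i| < n}`. -/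
noncomputable def dlam (lam : ℝ) (x y : TMC M) : ℝ :=
  sInf {r : ℝ | ∃ n : ℕ, (∀ i : ℤ, |i| < (n : ℤ) → x.1 i = y.1 i) ∧ r = lam ^ (-(n : ℤ))}

/-- The bracket (splicing) map: `[x,y]_n = y_n` for `n ≤ 0` and `[x,y]_n = x_n` for
`n ≥ 1`, defined when `x₀ = y₀` (junk value `x` otherwise). -/
noncomputable def bracket (x y : TMC M) : TMC M :=
  if h : x.1 0 = y.1 0 then
    ⟨fun n => if n ≤ 0 then y.1 n else x.1 n, by
      intro i
      by_cases h1 : i + 1 ≤ 0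
      · have h2 : i ≤ 0 := by omega
        simp only [if_pos h1, if_pos h2]
        exact y.2 i
      · by_cases h2 : i ≤ 0
        · have h3 : i = 0 := by omega
          subst h3
          simp only [if_neg h1, le_refl, if_pos]
          rw [← h]
          exact x.2 0
        · simp only [if_neg h1, if_neg h2]
          exact x.2 i⟩
  else x

/-- The local stable set `X^s(x,ε) = {y : d_λ(x,y) < ε, [x,y] = y}`. -/
def locStable (lam : ℝ) (x : TMC M) (ε : ℝ) : Set (TMC M) :=
  {y | dlam lam x y < ε ∧ bracket x y = y}

/-- The local unstable set `X^u(x,ε) = {y : d_λ(x,y) < ε, [y,x] = y}`. -/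
def locUnstable (lam : ℝ) (x : TMC M) (ε : ℝ) : Set (TMC M) :=
  {y | dlam lam x y < ε ∧ bracket y x = y}

/-- The global stable set `X^s(x) = {y : d_λ(σⁿx, σⁿy) → 0 as n → +∞}`. -/
def globStable (lam : ℝ) (x : TMC M) : Set (TMC M) :=
  {y | Filter.Tendsto (fun n : ℕ => dlam lam ((shift M)^[n] x) ((shift M)^[n] y))
        Filter.atTop (nhds 0)}

/-- The global unstable set `X^u(x) = {y : d_λ(σⁿx, σⁿy) → 0 as n → −∞}`. -/
def globUnstable (lam : ℝ) (x : TMC M) : Set (TMC M) :=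
  {y | Filter.Tendsto (fun n : ℕ => dlam lam ((shiftInv M)^[n] x) ((shiftInv M)^[n] y))
        Filter.atTop (nhds 0)}

/-- The (forward) `σ`-orbit of a point. -/
def orbit (q : TMC M) : Set (TMC M) := {y | ∃ k : ℕ, (shift M)^[k] q = y}

/-- `X^u(Q) = ∪_{q' ∈ Q} X^u(q')` for `Q` the orbit of `q`. -/
def XuQ (lam : ℝ) (q : TMC M) : Set (TMC M) := ⋃ q' ∈ orbit q, globUnstable lam q'

/-- The stable groupoid `G^s(Q) = {(x,y) : x,y ∈ X^u(Q), y ∈ X^s(x)}`. -/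
def GsQ (lam : ℝ) (q : TMC M) : Set (TMC M × TMC M) :=
  {a | a.1 ∈ XuQ lam q ∧ a.2 ∈ XuQ lam q ∧ a.2 ∈ globStable lam a.1}

/-- `c_s(a)`: the least `N ≥ 0` with `σ^N(a₂) ∈ X^s(σ^N(a₁), λ⁻¹)`. -/
noncomputable def cs (lam : ℝ) (a : TMC M × TMC M) : ℕ :=
  sInf {N : ℕ | (shift M)^[N] a.2 ∈ locStable lam ((shift M)^[N] a.1) lam⁻¹}

/-- The stable holonomy map `h^s(z) = σ^{-N}[σ^N(z), σ^N(c₁)]`. -/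
noncomputable def holS (N : ℕ) (c₁ z : TMC M) : TMC M :=
  (shiftInv M)^[N] (bracket ((shift M)^[N] z) ((shift M)^[N] c₁))

/-- The base set `V^s(c, η, N) = {(h^s(z), z) : z ∈ X^u(c₂, η)}`. -/
def Vs (lam : ℝ) (c : TMC M × TMC M) (η : ℝ) (N : ℕ) : Set (TMC M × TMC M) :=
  {b | b.2 ∈ locUnstable lam c.2 η ∧ b.1 = holS N c.1 b.2}

/-- `d_{s,λ}` on the stable groupoid. -/
noncomputable def dsl (lam : ℝ) (a b : TMC M × TMC M) : ℝ :=
  if b.2 ∈ locUnstable lam a.2 lam⁻¹ ∧ b.1 ∈ locUnstable lam a.1 lam⁻¹ then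
    max (dlam lam a.1 b.1) (dlam lam a.2 b.2)
  else 1

/-- The groupoid ultrametric `D_{s,λ}`. -/
noncomputable def Dsl (lam : ℝ) (a b : TMC M × TMC M) : ℝ :=
  if cs lam a = cs lam b then dsl lam a b else 1

/-- The induced metric `D̃_{s,λ}` on the unit space `X^u(Q)`. -/
noncomputable def DslUnits (lam : ℝ) (x y : TMC M) : ℝ :=
  if y ∈ locUnstable lam x lam⁻¹ then dlam lam x y else 1

end TMC

namespace TMC

variable {m : ℕ} {M : Fin m → Fin m → Bool}

theorem ext_coord {x y : TMC M} (h : ∀ i, x.1 i = y.1 i) : x = y :=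
  Subtype.ext (funext h)

theorem shift_iterate_coord (n : ℕ) (x : TMC M) (i : ℤ) :
    ((shift M)^[n] x).1 i = x.1 (i + n) := by
  induction n generalizing x with
  | zero => simp
  | succ k ih =>
    rw [Function.iterate_succ_apply, ih]
    exact congrArg x.1 (by push_cast; ring)

theorem shiftInv_iterate_coord (n : ℕ) (x : TMC M) (i : ℤ) :
    ((shiftInv M)^[n] x).1 i = x.1 (i - n) := by
  induction n generalizing x with
  | zero => simp
  | succ k ih =>
    rw [Function.iterate_succ_apply, ih]
    exact congrArg x.1 (by push_cast; ring)

theorem bracket_coord {x y : TMC M} (h : x.1 0 = y.1 0) (i : ℤ) :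
    (bracket x y).1 i = if i ≤ 0 then y.1 i else x.1 i :=
  congrFun (congrArg Subtype.val (dif_pos h)) i

theorem dlam_lt_zpow_neg_iff {lam : ℝ} (hlam : 1 < lam) (x y : TMC M) (k : ℕ) :
    dlam lam x y < lam ^ (-(k : ℤ)) ↔ ∀ i : ℤ, |i| ≤ k → x.1 i = y.1 i := by
  constructor
  · intro h i hi
    obtain ⟨r, ⟨n, hn, rfl⟩, hr⟩ := exists_lt_of_csInf_lt
      (by exact ⟨_, 0, fun i hi => absurd hi (not_lt.2 (abs_nonneg i)), rfl⟩) h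
    have := (zpow_lt_zpow_iff_right₀ hlam).1 hr
    exact hn i (by omega)
  · intro h
    have hle : dlam lam x y ≤ lam ^ (-((k + 1 : ℕ) : ℤ)) := by
      refine csInf_le ⟨0, ?_⟩ ⟨k + 1, fun i hi => h i (by push_cast at hi; omega), rfl⟩
      rintro _ ⟨n, -, rfl⟩
      exact zpow_nonneg (by linarith) _
    refine hle.trans_lt ((zpow_lt_zpow_iff_right₀ hlam).2 ?_)
    push_cast
    omega

theorem dlam_lt_inv_iff {lam : ℝ} (hlam : 1 < lam) (x y : TMC M) :
    dlam lam x y < lam⁻¹ ↔ ∀ i : ℤ, |i| ≤ 1 → x.1 i = y.1 i := by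
  simpa using dlam_lt_zpow_neg_iff hlam x y 1

theorem mem_locStable_inv_iff {lam : ℝ} (hlam : 1 < lam) (x y : TMC M) :
    y ∈ locStable lam x lam⁻¹ ↔ ∀ i : ℤ, -1 ≤ i → x.1 i = y.1 i := by
  change dlam lam x y < lam⁻¹ ∧ bracket x y = y ↔ _
  rw [dlam_lt_inv_iff hlam]
  constructor
  · rintro ⟨h, hb⟩ i hi
    by_cases h1 : i ≤ 0
    · exact h i (abs_le.2 ⟨hi, by omega⟩)
    · rw [← hb, bracket_coord (h 0 (by simp)), if_neg h1]
  · intro h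
    refine ⟨fun i hi => h i (abs_le.1 hi).1, ext_coord fun i => ?_⟩
    rw [bracket_coord (h 0 (by simp))]
    split_ifs with h1
    · rfl
    · exact h i (by omega)

theorem shift_iterate_mem_locStable_iff {lam : ℝ} (hlam : 1 < lam) (x y : TMC M) (K : ℕ) :
    (shift M)^[K] y ∈ locStable lam ((shift M)^[K] x) lam⁻¹ ↔
      ∀ i : ℤ, (K : ℤ) - 1 ≤ i → x.1 i = y.1 i := by
  simp only [mem_locStable_inv_iff hlam, shift_iterate_coord]
  constructor
  · intro h i hi
    simpa using h (i - K) (by omega)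
  · intro h i hi
    exact h (i + K) (by omega)

theorem cs_eq_sInf {lam : ℝ} (hlam : 1 < lam) (a : TMC M × TMC M) :
    cs lam a = sInf {K : ℕ | ∀ i : ℤ, (K : ℤ) - 1 ≤ i → a.1.1 i = a.2.1 i} := by
  simp only [cs, shift_iterate_mem_locStable_iff hlam]

theorem exists_forall_coord_eq_of_mem_globStable {lam : ℝ} (hlam : 1 < lam) {x y : TMC M}
    (h : y ∈ globStable lam x) :
    ∃ K : ℕ, ∀ i : ℤ, (K : ℤ) - 1 ≤ i → x.1 i = y.1 i := by
  have hpos : (0 : ℝ) < lam⁻¹ := inv_pos.2 (by linarith)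
  obtain ⟨K, hK⟩ := Filter.eventually_atTop.1 (Filter.Tendsto.eventually_lt_const hpos h)
  refine ⟨K + 1, fun i hi => ?_⟩
  push_cast at hi
  obtain ⟨j, rfl⟩ := Int.eq_ofNat_of_zero_le (show 0 ≤ i by omega)
  simpa [shift_iterate_coord] using
    (dlam_lt_inv_iff hlam _ _).1 (hK j (by omega)) 0 (by simp)

theorem coord_eq_of_cs_le {lam : ℝ} (hlam : 1 < lam) {a : TMC M × TMC M}
    (ha : a.2 ∈ globStable lam a.1) {i : ℤ} (hi : (cs lam a : ℤ) - 1 ≤ i) :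
    a.1.1 i = a.2.1 i := by
  rw [cs_eq_sInf hlam] at hi
  exact Nat.sInf_mem (exists_forall_coord_eq_of_mem_globStable hlam ha) i hi

theorem coord_eq_of_mem_locUnstable {lam : ℝ} (hlam : 1 < lam) {x y : TMC M} {k : ℕ}
    (h : y ∈ locUnstable lam x (lam ^ (-(k : ℤ)))) {i : ℤ} (hi : i ≤ k) :
    x.1 i = y.1 i := by
  obtain ⟨hd, hb⟩ := h
  rw [dlam_lt_zpow_neg_iff hlam] at hd
  by_cases h1 : i ≤ 0
  · rw [← hb, bracket_coord (hd 0 (by simp)).symm, if_pos h1]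
  · exact hd i (abs_le.2 ⟨by omega, hi⟩)

theorem holS_coord {n : ℕ} {c z : TMC M} (h : z.1 n = c.1 n) (i : ℤ) :
    (holS n c z).1 i = if i ≤ n then c.1 i else z.1 i := by
  rw [holS, shiftInv_iterate_coord, bracket_coord (by simpa [shift_iterate_coord] using h)]
  simp [shift_iterate_coord]

end TMC

open TMC in
/-- In an irreducible topological Markov chain with stable groupoid
`G^s(Q)`, if `a ∈ G^s(Q)` has `c_s(a) = N` and `n ≥ N`, then every
`b ∈ V^s(a, λ^{-n-1}, n)` satisfies `c_s(b) = N`. -/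
theorem tmc_baseSet_constant_cs {m : ℕ} (hm : 1 ≤ m) (M : Fin m → Fin m → Bool)
    (lam : ℝ) (hlam : 1 < lam)
    (hirr : ∀ U V : Set (TMC M), IsOpen U → IsOpen V → U.Nonempty → V.Nonempty →
      ∃ n : ℕ, ((shift M)^[n] '' U ∩ V).Nonempty)
    (q : TMC M) (hq : ∃ n : ℕ, 1 ≤ n ∧ (shift M)^[n] q = q)
    (a : TMC M × TMC M) (ha : a ∈ GsQ lam q)
    (N : ℕ) (hN : cs lam a = N) (n : ℕ) (hn : N ≤ n) :
    ∀ b ∈ Vs lam a (lam ^ (-(n : ℤ) - 1)) n, cs lam b = N := by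
  rintro ⟨b₁, b₂⟩ ⟨hb₂, hb₁⟩
  dsimp only at hb₂ hb₁
  have hη : (-(n : ℤ) - 1) = -((n + 1 : ℕ) : ℤ) := by push_cast; ring
  rw [hη] at hb₂
  have hab : ∀ i : ℤ, i ≤ n → a.2.1 i = b₂.1 i := fun i hi =>
    coord_eq_of_mem_locUnstable hlam hb₂ (by push_cast; omega)
  have haa : ∀ i : ℤ, (n : ℤ) ≤ i → a.1.1 i = a.2.1 i := fun i hi =>
    coord_eq_of_cs_le hlam ha.2.2 (by omega)
  have hb : ∀ i : ℤ, b₁.1 i = if i ≤ n then a.1.1 i else b₂.1 i := by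
    rw [hb₁]
    exact holS_coord ((hab n le_rfl).symm.trans (haa n le_rfl).symm)
  have hiff : ∀ i : ℤ, b₁.1 i = b₂.1 i ↔ a.1.1 i = a.2.1 i := by
    intro i
    rw [hb i]
    split_ifs with hi
    · rw [hab i hi]
    · simp [haa i (by omega)]
  rw [← hN, cs_eq_sInf hlam, cs_eq_sInf hlam]
  simp only [hiff]
end

section
/- Let (Σ_M, σ) be an irreducible topological Markov chain with ultrametric d_λ, λ > 1, Q a periodic orbit, and G^s(Q) the stable groupoid. Then D_{s,λ} is an ultrametric on G^s(Q): for all a, b, c ∈ G^s(Q) one has D_{s,λ}(a,b) = D_{s,λ}(b,a); D_{s,λ}(a,b) = 0 if and only if a = b; and D_{s,λ}(a,b) ≤ max{D_{s,λ}(a,c), D_{s,λ}(c,b)}. -/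
open scoped Classical

namespace TMC

section dlam

variable {m : ℕ} {M : Fin m → Fin m → Bool} {lam : ℝ}

theorem dlam_comm (x y : TMC M) : dlam lam x y = dlam lam y x := by
  simp only [dlam, eq_comm]

theorem dlam_le (hlam : 1 < lam) {x y : TMC M} {n : ℕ}
    (h : ∀ i : ℤ, |i| < (n : ℤ) → x.1 i = y.1 i) : dlam lam x y ≤ lam ^ (-(n : ℤ)) := by
  refine csInf_le ⟨0, ?_⟩ ⟨n, h, rfl⟩
  rintro r ⟨k, -, rfl⟩
  positivity

theorem dlam_nonneg (hlam : 1 < lam) (x y : TMC M) : 0 ≤ dlam lam x y := by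
  apply Real.sInf_nonneg
  rintro r ⟨k, -, rfl⟩
  positivity

theorem exists_agree_of_dlam_lt {x y : TMC M} {ε : ℝ} (h : dlam lam x y < ε) :
    ∃ n : ℕ, (∀ i : ℤ, |i| < (n : ℤ) → x.1 i = y.1 i) ∧ lam ^ (-(n : ℤ)) < ε := by
  obtain ⟨r, ⟨n, hn, rfl⟩, hr⟩ := exists_lt_of_csInf_lt
    (by exact ⟨1, 0, fun i hi => absurd hi (by simp), by simp⟩) h
  exact ⟨n, hn, hr⟩

theorem dlam_le_one (hlam : 1 < lam) (x y : TMC M) : dlam lam x y ≤ 1 := by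
  simpa using dlam_le (n := 0) (x := x) (y := y) hlam fun i hi => absurd hi (by simp)

theorem eq_of_dlam_lt (hlam : 1 < lam) {x y : TMC M} {n : ℕ}
    (h : dlam lam x y < lam ^ (-(n : ℤ))) {i : ℤ} (hi : |i| ≤ n) : x.1 i = y.1 i := by
  obtain ⟨k, hk, hlt⟩ := exists_agree_of_dlam_lt h
  have := (zpow_lt_zpow_iff_right₀ hlam).1 hlt
  exact hk i (by omega)

theorem dlam_self (hlam : 1 < lam) (x : TMC M) : dlam lam x x = 0 := by
  refine le_antisymm (le_of_forall_pos_lt_add fun ε hε => ?_) (dlam_nonneg hlam x x)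
  obtain ⟨n, hn⟩ := exists_pow_lt_of_lt_one hε (inv_lt_one_of_one_lt₀ hlam)
  rw [zero_add]
  refine (dlam_le (n := n) hlam fun _ _ => rfl).trans_lt ?_
  simpa [zpow_neg] using hn

theorem dlam_eq_zero (hlam : 1 < lam) {x y : TMC M} : dlam lam x y = 0 ↔ x = y := by
  refine ⟨fun h => Subtype.ext (funext fun i => ?_), fun h => h ▸ dlam_self hlam x⟩
  refine eq_of_dlam_lt (n := i.natAbs) hlam ?_ (by simp)
  rw [h]
  positivity

theorem dlam_triangle (hlam : 1 < lam) (x y z : TMC M) :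
    dlam lam x y ≤ max (dlam lam x z) (dlam lam z y) := by
  refine le_of_forall_gt_imp_ge_of_dense fun ε hε => ?_
  obtain ⟨h₁, h₂⟩ := max_lt_iff.1 hε
  obtain ⟨k, hk, hkε⟩ := exists_agree_of_dlam_lt h₁
  obtain ⟨l, hl, hlε⟩ := exists_agree_of_dlam_lt h₂
  refine (dlam_le (n := min k l) hlam fun i hi => ?_).trans ?_
  · exact (hk i (by omega)).trans (hl i (by omega))
  · rcases min_choice k l with h | h <;> rw [h]
    exacts [hkε.le, hlε.le]

theorem bracket_eq_left_iff {x y : TMC M} (h : y.1 0 = x.1 0) :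
    bracket y x = y ↔ ∀ n ≤ 0, y.1 n = x.1 n := by
  have hb : (bracket y x).1 = fun n => if n ≤ 0 then x.1 n else y.1 n :=
    congrArg Subtype.val (dif_pos h)
  refine Subtype.ext_iff.trans ?_
  rw [hb, funext_iff]
  refine forall_congr' fun n => ?_
  by_cases hn : n ≤ 0 <;> simp [hn, eq_comm]

theorem mem_locUnstable_inv_iff (hlam : 1 < lam) {x y : TMC M} :
    y ∈ locUnstable lam x lam⁻¹ ↔ dlam lam x y < lam⁻¹ ∧ ∀ n ≤ 0, y.1 n = x.1 n := by
  refine and_congr_right fun h => bracket_eq_left_iff ?_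
  exact (eq_of_dlam_lt (n := 1) hlam (by simpa using h) (by simp)).symm

theorem mem_locUnstable_inv_self (hlam : 1 < lam) (x : TMC M) :
    x ∈ locUnstable lam x lam⁻¹ := by
  rw [mem_locUnstable_inv_iff hlam, dlam_self hlam]
  exact ⟨by positivity, fun _ _ => rfl⟩

theorem mem_locUnstable_inv_comm (hlam : 1 < lam) {x y : TMC M} :
    y ∈ locUnstable lam x lam⁻¹ ↔ x ∈ locUnstable lam y lam⁻¹ := by
  rw [mem_locUnstable_inv_iff hlam, mem_locUnstable_inv_iff hlam, dlam_comm]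
  simp only [eq_comm]

theorem mem_locUnstable_inv_trans (hlam : 1 < lam) {x y z : TMC M}
    (hy : y ∈ locUnstable lam x lam⁻¹) (hz : z ∈ locUnstable lam y lam⁻¹) :
    z ∈ locUnstable lam x lam⁻¹ := by
  rw [mem_locUnstable_inv_iff hlam] at *
  exact ⟨(dlam_triangle hlam x z y).trans_lt (max_lt hy.1 hz.1),
    fun n hn => (hz.2 n hn).trans (hy.2 n hn)⟩

end dlam

section Dsl

variable {m : ℕ} {M : Fin m → Fin m → Bool} {lam : ℝ}

/-- The relation of `D_{s,λ}`-closeness, off which `D_{s,λ}` takes the value `1`. -/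
def DslNear (lam : ℝ) (a b : TMC M × TMC M) : Prop :=
  cs lam a = cs lam b ∧ b.2 ∈ locUnstable lam a.2 lam⁻¹ ∧ b.1 ∈ locUnstable lam a.1 lam⁻¹

theorem DslNear.refl (hlam : 1 < lam) (a : TMC M × TMC M) : DslNear lam a a :=
  ⟨rfl, mem_locUnstable_inv_self hlam _, mem_locUnstable_inv_self hlam _⟩

theorem DslNear.symm (hlam : 1 < lam) {a b : TMC M × TMC M} (h : DslNear lam a b) :
    DslNear lam b a :=
  ⟨h.1.symm, (mem_locUnstable_inv_comm hlam).1 h.2.1, (mem_locUnstable_inv_comm hlam).1 h.2.2⟩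

theorem DslNear.trans (hlam : 1 < lam) {a b c : TMC M × TMC M} (h : DslNear lam a b)
    (h' : DslNear lam b c) : DslNear lam a c :=
  ⟨h.1.trans h'.1, mem_locUnstable_inv_trans hlam h.2.1 h'.2.1,
    mem_locUnstable_inv_trans hlam h.2.2 h'.2.2⟩

theorem Dsl_of_near {a b : TMC M × TMC M} (h : DslNear lam a b) :
    Dsl lam a b = max (dlam lam a.1 b.1) (dlam lam a.2 b.2) := by
  rw [Dsl, if_pos h.1, dsl, if_pos h.2]

theorem Dsl_of_not_near {a b : TMC M × TMC M} (h : ¬ DslNear lam a b) : Dsl lam a b = 1 := by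
  unfold Dsl dsl
  split_ifs with h₁ h₂
  exacts [absurd ⟨h₁, h₂⟩ h, rfl, rfl]

theorem Dsl_le_one (hlam : 1 < lam) (a b : TMC M × TMC M) : Dsl lam a b ≤ 1 := by
  by_cases h : DslNear lam a b
  · rw [Dsl_of_near h]
    exact max_le (dlam_le_one hlam _ _) (dlam_le_one hlam _ _)
  · exact (Dsl_of_not_near h).le

theorem Dsl_comm (hlam : 1 < lam) (a b : TMC M × TMC M) : Dsl lam a b = Dsl lam b a := by
  by_cases h : DslNear lam a b
  · rw [Dsl_of_near h, Dsl_of_near (h.symm hlam), dlam_comm a.1, dlam_comm a.2]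
  · rw [Dsl_of_not_near h, Dsl_of_not_near fun h' => h (h'.symm hlam)]

theorem Dsl_eq_zero (hlam : 1 < lam) {a b : TMC M × TMC M} : Dsl lam a b = 0 ↔ a = b := by
  refine ⟨fun h => ?_, ?_⟩
  · by_cases hab : DslNear lam a b
    · rw [Dsl_of_near hab] at h
      have h₁ := (le_max_left _ _).trans h.le
      have h₂ := (le_max_right _ _).trans h.le
      exact Prod.ext ((dlam_eq_zero hlam).1 (h₁.antisymm (dlam_nonneg hlam _ _)))
        ((dlam_eq_zero hlam).1 (h₂.antisymm (dlam_nonneg hlam _ _)))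
    · rw [Dsl_of_not_near hab] at h
      exact absurd h one_ne_zero
  · rintro rfl
    rw [Dsl_of_near (.refl hlam a), dlam_self hlam, dlam_self hlam, max_self]

theorem Dsl_triangle (hlam : 1 < lam) (a b c : TMC M × TMC M) :
    Dsl lam a b ≤ max (Dsl lam a c) (Dsl lam c b) := by
  by_cases hac : DslNear lam a c
  · by_cases hcb : DslNear lam c b
    · rw [Dsl_of_near (hac.trans hlam hcb), Dsl_of_near hac, Dsl_of_near hcb,
        max_max_max_comm]
      exact max_le_max (dlam_triangle hlam _ _ _) (dlam_triangle hlam _ _ _)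
    · rw [Dsl_of_not_near hcb]
      exact (Dsl_le_one hlam a b).trans (le_max_right _ _)
  · rw [Dsl_of_not_near hac]
    exact (Dsl_le_one hlam a b).trans (le_max_left _ _)

end Dsl

end TMC

open TMC in
/-- In an irreducible topological Markov chain with stable groupoid
`G^s(Q)`, the function `D_{s,λ}` is an ultrametric on `G^s(Q)`: it is symmetric, vanishes
exactly on the diagonal, and satisfies the strong triangle inequality. -/
theorem tmc_Dsl_ultrametric {m : ℕ} (hm : 1 ≤ m) (M : Fin m → Fin m → Bool)
    (lam : ℝ) (hlam : 1 < lam)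
    (hirr : ∀ U V : Set (TMC M), IsOpen U → IsOpen V → U.Nonempty → V.Nonempty →
      ∃ n : ℕ, ((shift M)^[n] '' U ∩ V).Nonempty)
    (q : TMC M) (hq : ∃ n : ℕ, 1 ≤ n ∧ (shift M)^[n] q = q) :
    ∀ a ∈ GsQ lam q, ∀ b ∈ GsQ lam q, ∀ c ∈ GsQ lam q,
      Dsl lam a b = Dsl lam b a ∧
      (Dsl lam a b = 0 ↔ a = b) ∧
      Dsl lam a b ≤ max (Dsl lam a c) (Dsl lam c b) := by
  exact fun a _ b _ c _ =>
    ⟨Dsl_comm hlam a b, Dsl_eq_zero hlam, Dsl_triangle hlam a b c⟩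
end
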